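/- Let q be a prime power and m ≥ 0 an integer. For n ≥ 1 and i ≥ 0 let p_n(i) := #{M ∈ Mat_{n×(n+m)}(F_q) : n − rank M = i} / q^{n(n+m)} be the probability that a uniformly random n×(n+m) matrix over F_q has corank i. Then |Σ_{i=0}^{∞} |p_n(i) − π_m(i)| − (2π_m(0)/((q−1)q^m))·q^{−n}| ≤ (π_m(0)^{−2} − 1)^{1/2} · q^{−2n}. -/

import Mathlib

noncomputable section

/-- `η_k(q) = ∏_{i=1}^{k} (1 - q^{-i})`. -/
def etaF (q : ℝ) (k : ℕ) : ℝ := ∏ i ∈ Finset.range k, (1 - q⁻¹ ^ (i + 1))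

/-- `η_∞(q) = ∏_{i=1}^{∞} (1 - q^{-i})`. -/
def etaInf (q : ℝ) : ℝ := ∏' i : ℕ, (1 - q⁻¹ ^ (i + 1))

/-- The Cohen–Lenstra distribution `π_m(i) = η_∞(q)/(q^{i(i+m)}·η_i(q)·η_{i+m}(q))`. -/
def piCL (q m i : ℕ) : ℝ :=
  etaInf q / ((q : ℝ) ^ (i * (i + m)) * etaF q i * etaF q (i + m))

open Module in
theorem finrank_span_range_cons {K V : Type*} [Field K] [AddCommGroup V] [Module K V]
    [FiniteDimensional K V] {n : ℕ} (w : V) (v : Fin n → V) [Decidable (w ∈ Submodule.span K (Set.range v))] :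
    finrank K (Submodule.span K (Set.range (Fin.cons w v : Fin (n + 1) → V))) =
      finrank K (Submodule.span K (Set.range v)) +
        if w ∈ Submodule.span K (Set.range v) then 0 else 1 := by
  rw [Fin.range_cons]
  split_ifs with h
  · rw [Submodule.span_insert_eq_span h, add_zero]
  · have hw : w ≠ 0 := fun h0 => h (h0 ▸ Submodule.zero_mem _)
    have := Submodule.finrank_sup_add_finrank_inf_eq (K ∙ w) (Submodule.span K (Set.range v))
    rw [Submodule.span_insert, ← add_right_cancel_iff, this, finrank_span_singleton hw,
      (disjoint_iff.mp ((Submodule.disjoint_span_singleton' hw).mpr h).symm), finrank_bot]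
    ring

open Module in
/-- The number of `n`-tuples of vectors spanning a subspace of dimension `r`. -/
noncomputable def tupleRankCount (K V : Type*) [Field K] [AddCommGroup V] [Module K V] (n r : ℕ) : ℕ :=
  Nat.card {v : Fin n → V // finrank K (Submodule.span K (Set.range v)) = r}

open Module Classical in
theorem tupleRankCount_eq_sum {K V : Type*} [Field K] [AddCommGroup V] [Module K V] [Fintype V]
    (n r : ℕ) : (tupleRankCount K V n r : ℝ) =
      ∑ v : Fin n → V, if finrank K (Submodule.span K (Set.range v)) = r then (1 : ℝ) else 0 := by
  rw [tupleRankCount, Nat.card_eq_fintype_card, Fintype.card_subtype]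
  simp

open Module Classical in
theorem sum_ite_mem_submodule {K V : Type*} [Field K] [Fintype K] [AddCommGroup V] [Module K V]
    [Fintype V] (S : Submodule K V) (a b : ℝ) :
    ∑ w : V, (if w ∈ S then a else b) = (Fintype.card K : ℝ) ^ finrank K S * a +
      ((Fintype.card K : ℝ) ^ finrank K V - (Fintype.card K : ℝ) ^ finrank K S) * b := by
  have h1 : (Finset.univ.filter (fun w : V => w ∈ S)).card = Fintype.card K ^ finrank K S := by
    rw [← Module.card_eq_pow_finrank (K := K) (V := S), ← Fintype.card_subtype]
  have h2 := Finset.card_filter_add_card_filter_not (s := (Finset.univ : Finset V)) (fun w : V => w ∈ S)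
  rw [Finset.card_univ, Module.card_eq_pow_finrank (K := K) (V := V), h1] at h2
  have h3 : ((Finset.univ.filter (fun w : V => w ∉ S)).card : ℝ) =
      (Fintype.card K : ℝ) ^ finrank K V - (Fintype.card K : ℝ) ^ finrank K S := by
    rw [eq_sub_iff_add_eq']; exact_mod_cast h2
  rw [Finset.sum_ite, Finset.sum_const, Finset.sum_const, nsmul_eq_mul, nsmul_eq_mul, h3, h1]
  push_cast; rfl

open Module Classical in
theorem tupleRankCount_succ_succ {K V : Type*} [Field K] [Fintype K] [AddCommGroup V] [Module K V]
    [Fintype V] (n r : ℕ) : (tupleRankCount K V (n + 1) (r + 1) : ℝ) =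
      (Fintype.card K : ℝ) ^ (r + 1) * tupleRankCount K V n (r + 1) +
      ((Fintype.card K : ℝ) ^ finrank K V - (Fintype.card K : ℝ) ^ r) * tupleRankCount K V n r := by
  rw [tupleRankCount_eq_sum, ← (Fin.consEquiv (fun _ => V)).sum_comp, Fintype.sum_prod_type_right,
    tupleRankCount_eq_sum, tupleRankCount_eq_sum, Finset.mul_sum, Finset.mul_sum,
    ← Finset.sum_add_distrib]
  refine Finset.sum_congr rfl fun v _ => ?_
  set d := finrank K (Submodule.span K (Set.range v)) with hd
  have : ∀ w : V, (if finrank K (Submodule.span K (Set.range (Fin.consEquiv (fun _ => V) (w, v)))) = r + 1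
      then (1 : ℝ) else 0) = if w ∈ Submodule.span K (Set.range v) then
        (if d = r + 1 then 1 else 0) else (if d = r then 1 else 0) := by
    intro w
    have h : finrank K (Submodule.span K (Set.range (Fin.consEquiv (fun _ => V) (w, v)))) = _ :=
      finrank_span_range_cons (K := K) w v
    rw [h]
    split_ifs <;> first | rfl | omega
  rw [Finset.sum_congr rfl fun w _ => this w, sum_ite_mem_submodule, ← hd]
  split_ifs <;> simp_all

open Module Classical in
theorem tupleRankCount_zero_right {K V : Type*} [Field K] [AddCommGroup V] [Module K V]
    [Fintype V] (n : ℕ) : tupleRankCount K V n 0 = 1 := by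
  rw [tupleRankCount, Nat.card_eq_one_iff_exists]
  refine ⟨⟨0, ?_⟩, fun v => Subtype.ext (funext fun i => ?_)⟩
  · rw [Submodule.finrank_eq_zero, Submodule.span_eq_bot]
    rintro _ ⟨i, rfl⟩; rfl
  · have := v.2
    rw [Submodule.finrank_eq_zero, Submodule.span_eq_bot] at this
    exact this _ ⟨i, rfl⟩

open Module in
theorem tupleRankCount_zero_succ {K V : Type*} [Field K] [AddCommGroup V] [Module K V]
    (r : ℕ) : tupleRankCount K V 0 (r + 1) = 0 := by
  rw [tupleRankCount, Nat.card_eq_zero]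
  refine Or.inl ⟨fun v => ?_⟩
  have := v.2
  rw [Set.range_eq_empty, Submodule.span_empty, finrank_bot] at this
  omega

/-- `∏_{j<r} (x - q^j)`. -/
noncomputable def qFalling (q x : ℝ) (r : ℕ) : ℝ := ∏ j ∈ Finset.range r, (x - q ^ j)

theorem qFalling_succ (q x : ℝ) (r : ℕ) : qFalling q x (r + 1) = qFalling q x r * (x - q ^ r) :=
  Finset.prod_range_succ _ _

theorem qFalling_mul_succ (q x : ℝ) (r : ℕ) :
    qFalling q (q * x) (r + 1) = (q * x - 1) * q ^ r * qFalling q x r := by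
  rw [qFalling, Finset.prod_range_succ', pow_zero]
  simp only [pow_succ', ← mul_sub, Finset.prod_mul_distrib, Finset.prod_const, Finset.card_range,
    qFalling]
  ring

open Module in
theorem tupleRankCount_mul_qFalling {K V : Type*} [Field K] [Fintype K] [AddCommGroup V]
    [Module K V] [Fintype V] (n r : ℕ) :
    (tupleRankCount K V n r : ℝ) * qFalling (Fintype.card K) ((Fintype.card K : ℝ) ^ r) r =
      qFalling (Fintype.card K) ((Fintype.card K : ℝ) ^ finrank K V) r *
        qFalling (Fintype.card K) ((Fintype.card K : ℝ) ^ n) r := by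
  induction n generalizing r with
  | zero =>
    cases r with
    | zero => simp [tupleRankCount_zero_right, qFalling]
    | succ r =>
      have : qFalling (Fintype.card K) ((Fintype.card K : ℝ) ^ 0) (r + 1) = 0 :=
        Finset.prod_eq_zero (Finset.mem_range.mpr r.succ_pos) (by simp)
      rw [tupleRankCount_zero_succ, this]; simp
  | succ n ih =>
    cases r with
    | zero => simp [tupleRankCount_zero_right, qFalling]
    | succ r =>
      have h1 := ih (r + 1)
      have h2 := ih r
      rw [tupleRankCount_succ_succ, add_mul, mul_assoc, h1, pow_succ' _ r, pow_succ' _ n,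
        qFalling_mul_succ, qFalling_mul_succ, qFalling_succ, qFalling_succ]
      linear_combination ((Fintype.card K : ℝ) ^ finrank K V - (Fintype.card K : ℝ) ^ r) *
        ((Fintype.card K : ℝ) * (Fintype.card K : ℝ) ^ r - 1) * (Fintype.card K : ℝ) ^ r * h2

theorem inv_pow_succ_lt_one {q : ℝ} (hq : 1 < q) (i : ℕ) : q⁻¹ ^ (i + 1) < 1 :=
  pow_lt_one₀ (by positivity) (inv_lt_one_of_one_lt₀ hq) i.succ_ne_zero

theorem etaF_zero (q : ℝ) : etaF q 0 = 1 := by simp [etaF]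

theorem etaF_succ (q : ℝ) (k : ℕ) : etaF q (k + 1) = etaF q k * (1 - q⁻¹ ^ (k + 1)) :=
  Finset.prod_range_succ _ _

theorem etaF_pos {q : ℝ} (hq : 1 < q) (k : ℕ) : 0 < etaF q k :=
  Finset.prod_pos fun i _ => sub_pos.mpr (inv_pow_succ_lt_one hq i)

theorem etaF_antitone {q : ℝ} (hq : 1 < q) : Antitone (etaF q) := by
  refine antitone_nat_of_succ_le fun k => ?_
  rw [etaF_succ]
  exact mul_le_of_le_one_right (etaF_pos hq k).le (sub_le_self _ (by positivity))

theorem tendsto_etaF {q : ℝ} (hq : 1 < q) :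
    Filter.Tendsto (etaF q) Filter.atTop (nhds (etaInf q)) := by
  refine Multipliable.tendsto_prod_tprod_nat ?_
  simp only [sub_eq_add_neg]
  refine Real.multipliable_one_add_of_summable ?_
  refine Summable.neg ?_
  exact (summable_nat_add_iff 1).mpr
    (summable_geometric_of_lt_one (by positivity) (inv_lt_one_of_one_lt₀ hq))

theorem etaInf_le_etaF {q : ℝ} (hq : 1 < q) (k : ℕ) : etaInf q ≤ etaF q k :=
  (etaF_antitone hq).le_of_tendsto (tendsto_etaF hq) k

theorem etaF_add_bounds {q : ℝ} (hq : 1 < q) (k j : ℕ) :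
    etaF q k * (1 - q⁻¹ ^ k / (q - 1) * (1 - q⁻¹ ^ j)) ≤ etaF q (k + j) ∧
      etaF q (k + j) * (1 + q⁻¹ ^ k / (q - 1) * (1 - q⁻¹ ^ j)) ≤ etaF q k := by
  induction j with
  | zero => simp
  | succ j ih =>
    have hq0 : 0 < q - 1 := sub_pos.mpr hq
    have hk := etaF_pos hq k
    have hkj := etaF_pos hq (k + j)
    have hs : 0 ≤ q⁻¹ ^ k / (q - 1) * (1 - q⁻¹ ^ j) :=
      mul_nonneg (by positivity)
        (sub_nonneg.mpr (pow_le_one₀ (by positivity) (inv_lt_one_of_one_lt₀ hq).le))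
    have hx : 0 < q⁻¹ ^ (k + j + 1) := by positivity
    have hx1 := inv_pow_succ_lt_one hq (k + j)
    have hstep : q⁻¹ ^ k / (q - 1) * (1 - q⁻¹ ^ (j + 1)) =
        q⁻¹ ^ k / (q - 1) * (1 - q⁻¹ ^ j) + q⁻¹ ^ (k + j + 1) := by
      have : q ≠ 0 := by positivity
      rw [pow_succ, pow_succ, pow_add]
      field_simp
      ring
    rw [hstep, ← add_assoc, etaF_succ]
    set s := q⁻¹ ^ k / (q - 1) * (1 - q⁻¹ ^ j)
    set x := q⁻¹ ^ (k + j + 1)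
    have hle := etaF_antitone hq (Nat.le_add_right k j)
    constructor
    · nlinarith [mul_nonneg hx.le (sub_nonneg.mpr hle), ih.1]
    · nlinarith [mul_nonneg hkj.le (mul_nonneg hx.le hs), mul_nonneg hkj.le (mul_nonneg hx.le hx.le), ih.2]

theorem etaInf_bounds {q : ℝ} (hq : 1 < q) (k : ℕ) :
    etaF q k * (1 - q⁻¹ ^ k / (q - 1)) ≤ etaInf q ∧
      etaInf q * (1 + q⁻¹ ^ k / (q - 1)) ≤ etaF q k := by
  have ht : Filter.Tendsto (fun j => etaF q (k + j)) Filter.atTop (nhds (etaInf q)) := by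
    simpa only [add_comm k] using (Filter.tendsto_add_atTop_iff_nat k).mpr (tendsto_etaF hq)
  have hp : Filter.Tendsto (fun j : ℕ => q⁻¹ ^ k / (q - 1) * (1 - q⁻¹ ^ j)) Filter.atTop
      (nhds (q⁻¹ ^ k / (q - 1))) := by
    simpa using ((tendsto_pow_atTop_nhds_zero_of_lt_one (by positivity)
      (inv_lt_one_of_one_lt₀ hq)).const_sub 1).const_mul (q⁻¹ ^ k / (q - 1))
  exact ⟨le_of_tendsto_of_tendsto' ((hp.const_sub 1).const_mul _) ht
      fun j => (etaF_add_bounds hq k j).1,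
    le_of_tendsto' (ht.mul (hp.const_add 1)) fun j => (etaF_add_bounds hq k j).2⟩

theorem etaInf_pos {q : ℝ} (hq : 1 < q) : 0 < etaInf q := by
  obtain ⟨k, hk⟩ := exists_pow_lt_of_lt_one (sub_pos.mpr hq) (inv_lt_one_of_one_lt₀ hq)
  refine lt_of_lt_of_le (mul_pos (etaF_pos hq k) ?_) (etaInf_bounds hq k).1
  rw [sub_pos, div_lt_one (sub_pos.mpr hq)]
  exact hk

theorem piCL_pos {q : ℕ} (hq : 1 < q) (m i : ℕ) : 0 < piCL q m i := by
  have hq' : (1 : ℝ) < q := by exact_mod_cast hq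
  have := etaF_pos hq' i
  have := etaF_pos hq' (i + m)
  have := etaInf_pos hq'
  unfold piCL
  positivity

theorem summable_piCL {q : ℕ} (hq : 1 < q) (m : ℕ) : Summable (piCL q m) := by
  have hq' : (1 : ℝ) < q := by exact_mod_cast hq
  have hI := etaInf_pos hq'
  refine Summable.of_nonneg_of_le (fun i => (piCL_pos hq m i).le) (fun i => ?_)
    ((summable_geometric_of_lt_one (r := (q : ℝ)⁻¹) (by positivity)
      (inv_lt_one_of_one_lt₀ hq')).mul_left (etaInf q)⁻¹)
  have h1 := etaF_pos hq' i
  have h2 := etaF_pos hq' (i + m)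
  have h3 : (q : ℝ) ^ i ≤ (q : ℝ) ^ (i * (i + m)) := by
    refine pow_le_pow_right₀ hq'.le ?_
    rcases i with _ | i
    · simp
    · exact Nat.le_mul_of_pos_right _ (by omega)
  rw [inv_pow, ← mul_inv, piCL, div_le_iff₀ (by positivity), inv_mul_eq_div, le_div_iff₀ (by positivity)]
  calc etaInf q * (etaInf q * (q : ℝ) ^ i) = (q : ℝ) ^ i * etaInf q * etaInf q := by ring
    _ ≤ _ := by
      gcongr
      · exact etaInf_le_etaF hq' i
      · exact etaInf_le_etaF hq' (i + m)

theorem qFalling_pow {q : ℝ} (hq : 1 < q) {N r : ℕ} (h : r ≤ N) :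
    qFalling q (q ^ N) r * etaF q (N - r) = q ^ (N * r) * etaF q N := by
  induction r with
  | zero => simp [qFalling]
  | succ r ih =>
    have ih := ih (by omega)
    have hN : N - r = N - (r + 1) + 1 := by omega
    rw [hN, etaF_succ, ← hN] at ih
    have : (q ^ N - q ^ r : ℝ) = q ^ N * (1 - q⁻¹ ^ (N - r)) := by
      have hq0 : q ≠ 0 := by positivity
      have : (q ^ N : ℝ) = q ^ r * q ^ (N - r) := by rw [← pow_add]; congr 1; omega
      rw [mul_sub, inv_pow, mul_one, this, mul_assoc, mul_inv_cancel₀ (by positivity), mul_one]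
    rw [qFalling_succ, this, Nat.mul_succ, pow_add]
    linear_combination (q ^ N) * ih

/-- The proportion of `n × (n + m)` matrices over `F` having corank `i`. -/
def corankProb (F : Type) [Field F] [Fintype F] (m n i : ℕ) : ℝ :=
  (Nat.card {M : Matrix (Fin n) (Fin (n + m)) F // n - M.rank = i} : ℝ)
    / (Fintype.card F : ℝ) ^ (n * (n + m))

theorem corankProb_eq_zero (F : Type) [Field F] [Fintype F] {m n i : ℕ} (h : n < i) :
    corankProb F m n i = 0 := by
  have : IsEmpty {M : Matrix (Fin n) (Fin (n + m)) F // n - M.rank = i} :=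
    ⟨fun M => by have := M.2; omega⟩
  rw [corankProb, Nat.card_of_isEmpty, Nat.cast_zero, zero_div]

theorem card_corank_eq_tupleRankCount (F : Type) [Field F] (m : ℕ) {n i : ℕ} (h : i ≤ n) :
    Nat.card {M : Matrix (Fin n) (Fin (n + m)) F // n - M.rank = i} =
      tupleRankCount F (Fin (n + m) → F) n (n - i) := by
  refine Nat.card_congr (Equiv.subtypeEquiv Matrix.of.symm fun M => ?_)
  have h1 : M.rank ≤ n := by simpa using M.rank_le_height
  have h2 : M.rank = Module.finrank F (Submodule.span F (Set.range (Matrix.of.symm M))) :=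
    M.rank_eq_finrank_span_row
  rw [← h2]
  omega

theorem corankProb_eq (F : Type) [Field F] [Fintype F] {m n i : ℕ} (h : i ≤ n) :
    corankProb F m n i = piCL (Fintype.card F) m i *
      (etaF (Fintype.card F) n * etaF (Fintype.card F) (n + m) /
        (etaInf (Fintype.card F) * etaF (Fintype.card F) (n - i))) := by
  have hq : (1 : ℝ) < Fintype.card F := by exact_mod_cast Fintype.one_lt_card
  have hcount := tupleRankCount_mul_qFalling (K := F) (V := Fin (n + m) → F) n (n - i)
  have h1 := qFalling_pow hq (le_refl (n - i))
  have h2 := qFalling_pow hq (show n - i ≤ n + m by omega)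
  have h3 := qFalling_pow hq (show n - i ≤ n by omega)
  rw [← card_corank_eq_tupleRankCount F m h, Module.finrank_fin_fun] at hcount
  rw [Nat.sub_self, etaF_zero, mul_one] at h1
  rw [show n + m - (n - i) = i + m by omega] at h2
  rw [Nat.sub_sub_self h] at h3
  rw [h1] at hcount
  rw [corankProb, piCL]
  set c : ℝ := (Nat.card {M : Matrix (Fin n) (Fin (n + m)) F // n - M.rank = i} : ℝ)
  set q : ℝ := (Fintype.card F : ℝ)
  have e0 := etaInf_pos hq
  have e1 := etaF_pos hq i
  have e2 := etaF_pos hq (i + m)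
  have e3 := etaF_pos hq (n - i)
  have hq0 : 0 < q := by positivity
  have key : c * q ^ ((n - i) * (n - i)) * etaF q (n - i) * (etaF q i * etaF q (i + m)) =
      q ^ ((n + m) * (n - i)) * q ^ (n * (n - i)) * (etaF q n * etaF q (n + m)) := by
    linear_combination etaF q i * etaF q (i + m) * hcount +
      qFalling q (q ^ n) (n - i) * etaF q i * h2 + q ^ ((n + m) * (n - i)) * etaF q (n + m) * h3
  have hpow : q ^ ((n + m) * (n - i)) * q ^ (n * (n - i)) * q ^ (i * (i + m)) =
      q ^ (n * (n + m)) * q ^ ((n - i) * (n - i)) := by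
    rw [← pow_add, ← pow_add, ← pow_add]
    congr 1
    obtain ⟨r, rfl⟩ := Nat.exists_eq_add_of_le h
    rw [Nat.add_sub_cancel_left]
    ring
  rw [div_mul_div_comm, div_eq_div_iff (by positivity) (by positivity)]
  have hr : 0 < q ^ ((n - i) * (n - i)) := by positivity
  refine mul_right_cancel₀ hr.ne' ?_
  linear_combination etaInf q * q ^ (i * (i + m)) * key +
    etaInf q * etaF q n * etaF q (n + m) * hpow

theorem hasSum_corankProb (F : Type) [Field F] [Fintype F] (m n : ℕ) :
    HasSum (corankProb F m n) 1 := by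
  classical
  have hq : (1 : ℝ) < Fintype.card F := by exact_mod_cast Fintype.one_lt_card
  have hsum : ∑ i ∈ Finset.range (n + 1), corankProb F m n i = 1 := by
    simp only [corankProb]
    rw [← Finset.sum_div, div_eq_one_iff_eq (by positivity)]
    have := Finset.card_eq_sum_card_fiberwise (s := (Finset.univ : Finset (Matrix (Fin n) (Fin (n + m)) F)))
      (f := fun M => n - M.rank) (t := Finset.range (n + 1)) (fun M _ => by simp)
    have hc : Finset.card (Finset.univ : Finset (Matrix (Fin n) (Fin (n + m)) F)) =
        Fintype.card F ^ (n * (n + m)) := by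
      rw [Finset.card_univ, Fintype.card_congr Matrix.of.symm]; simp [← pow_mul, mul_comm]
    rw [hc] at this
    simp only [Nat.card_eq_fintype_card, Fintype.card_subtype]
    exact_mod_cast this.symm
  rw [← hsum]
  exact hasSum_sum_of_ne_finset_zero fun i hi => corankProb_eq_zero F (by simpa using hi)

theorem tendsto_corankProb (F : Type) [Field F] [Fintype F] (m i : ℕ) :
    Filter.Tendsto (fun n => corankProb F m n i) Filter.atTop
      (nhds (piCL (Fintype.card F) m i)) := by
  have hq : (1 : ℝ) < Fintype.card F := by exact_mod_cast Fintype.one_lt_card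
  have h0 := etaInf_pos hq
  have ht := tendsto_etaF hq
  have h1 := (Filter.tendsto_add_atTop_iff_nat m).mpr ht
  have h2 := ht.comp (Filter.tendsto_sub_atTop_nat i)
  have h3 := ((ht.mul h1).div (h2.const_mul (etaInf (Fintype.card F)))
    (by positivity)).const_mul (piCL (Fintype.card F) m i)
  rw [div_self (by positivity), mul_one] at h3
  refine h3.congr' ?_
  filter_upwards [Filter.eventually_ge_atTop i] with n hn
  exact (corankProb_eq F hn).symm

theorem corankProb_le (F : Type) [Field F] [Fintype F] (m n i : ℕ) :
    corankProb F m n i ≤ (etaInf (Fintype.card F))⁻¹ * piCL (Fintype.card F) m i := by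
  have hq : (1 : ℝ) < Fintype.card F := by exact_mod_cast Fintype.one_lt_card
  have h0 := etaInf_pos hq
  have hp := piCL_pos (Fintype.one_lt_card (α := F)) m i
  rcases lt_or_ge n i with h | h
  · rw [corankProb_eq_zero F h]
    positivity
  · rw [corankProb_eq F h, mul_comm]
    refine mul_le_mul_of_nonneg_right ?_ hp.le
    have h1 := etaF_pos hq (n - i)
    have h2 := etaF_antitone hq (Nat.sub_le n i)
    have h3 := etaF_antitone hq (Nat.zero_le (n + m))
    rw [etaF_zero] at h3
    rw [div_le_iff₀ (by positivity), inv_mul_cancel_left₀ h0.ne']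
    exact (mul_le_of_le_one_right (etaF_pos hq n).le h3).trans h2

theorem hasSum_piCL (F : Type) [Field F] [Fintype F] (m : ℕ) :
    HasSum (piCL (Fintype.card F) m) 1 := by
  have hs := summable_piCL (Fintype.one_lt_card (α := F)) m
  have ht := tendsto_tsum_of_dominated_convergence (𝓕 := Filter.atTop)
    (hs.mul_left (etaInf (Fintype.card F))⁻¹) (tendsto_corankProb F m)
    (Filter.Eventually.of_forall fun n i => by
      have h0 : 0 ≤ corankProb F m n i := by unfold corankProb; positivity
      rw [Real.norm_of_nonneg h0]
      exact corankProb_le F m n i)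
  simp only [(hasSum_corankProb F m _).tsum_eq] at ht
  rw [tendsto_nhds_unique tendsto_const_nhds ht]
  exact hs.hasSum

theorem corankProb_le_piCL (F : Type) [Field F] [Fintype F] (m n : ℕ) {i : ℕ} (hi : i ≠ 0) :
    corankProb F m n i ≤ piCL (Fintype.card F) m i := by
  have hq : (1 : ℝ) < Fintype.card F := by exact_mod_cast Fintype.one_lt_card
  have hq2 : (2 : ℝ) ≤ Fintype.card F := by exact_mod_cast Fintype.one_lt_card
  have hp := piCL_pos (Fintype.one_lt_card (α := F)) m i
  rcases lt_or_ge n i with h | h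
  · rw [corankProb_eq_zero F h]
    exact hp.le
  · rw [corankProb_eq F h]
    refine mul_le_of_le_one_right hp.le ?_
    have hb := (etaInf_bounds hq (n + m)).1
    set q : ℝ := (Fintype.card F : ℝ)
    have h0 := etaInf_pos hq
    have h1 := etaF_pos hq (n - i)
    have h2 := etaF_antitone hq (show n - i ≤ n - 1 by omega)
    have h3 := etaF_succ q (n - 1)
    rw [Nat.sub_add_cancel (by omega)] at h3
    have hz : q⁻¹ ^ (n + m) / (q - 1) ≤ q⁻¹ ^ n :=
      (div_le_self (by positivity) (by linarith)).trans
        (pow_le_pow_of_le_one (by positivity) (inv_le_one_of_one_le₀ hq.le) (Nat.le_add_right n m))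
    have hx : 0 ≤ 1 - q⁻¹ ^ n :=
      sub_nonneg.mpr (pow_le_one₀ (by positivity) (inv_le_one_of_one_le₀ hq.le))
    have h4 := etaF_pos hq (n + m)
    rw [div_le_one (by positivity), h3]
    calc etaF q (n - 1) * (1 - q⁻¹ ^ n) * etaF q (n + m)
        ≤ etaF q (n - i) * (1 - q⁻¹ ^ n) * etaF q (n + m) := by gcongr
      _ = etaF q (n + m) * (1 - q⁻¹ ^ n) * etaF q (n - i) := by ring
      _ ≤ etaF q (n + m) * (1 - q⁻¹ ^ (n + m) / (q - 1)) * etaF q (n - i) := by gcongr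
      _ ≤ etaInf q * etaF q (n - i) := by gcongr

theorem tsum_abs_sub_of_hasSum_one {p r : ℕ → ℝ} (hp : HasSum p 1) (hr : HasSum r 1)
    (h0 : r 0 ≤ p 0) (h : ∀ i, i ≠ 0 → p i ≤ r i) :
    ∑' i, |p i - r i| = 2 * (p 0 - r 0) := by
  have h1 := (hr.sub hp).add (hasSum_ite_eq 0 (2 * (p 0 - r 0)))
  rw [sub_self, zero_add] at h1
  rw [← h1.tsum_eq]
  refine tsum_congr fun i => ?_
  split_ifs with hi
  · subst hi
    rw [abs_of_nonneg (by linarith)]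
    ring
  · rw [abs_of_nonpos (by linarith [h i hi])]
    ring

/-- Error estimate for `2P(1/R - 1) - 2Pay`, where `P = π_m(0)`, `R = ∏_{j>n+m}(1 - q^{-j})`,
`a = q^{-m}/(q-1)` and `y = q^{-n}`. -/
theorem abs_two_mul_inv_sub_le {P R a y : ℝ} (hP : 0 < P) (ha : 0 < a) (hy : 0 < y)
    (hy2 : y ≤ 1 / 2) (haP : P * (1 + a) ≤ 1) (hR1 : 1 - a * y ≤ R) (hR2 : R * (1 + a * y) ≤ 1)
    (h : a ≤ 1 / 2 ∨ a ≤ 1 ∧ P ≤ 3 / 8) :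
    |2 * (P * R⁻¹ - P) - 2 * P * a * y| ≤ Real.sqrt (P⁻¹ ^ 2 - 1) * y ^ 2 := by
  have ha1 : a ≤ 1 := by rcases h with h | h <;> linarith [h]
  have hay : a * y ≤ 1 / 2 := by nlinarith
  have hR : 0 < R := by linarith
  have hl : a * y ≤ R⁻¹ - 1 := by
    rw [le_sub_iff_add_le', inv_eq_one_div, le_div_iff₀ hR]
    linarith
  have hu : R⁻¹ - 1 ≤ a * y + (a * y) ^ 2 / (1 - a * y) := by
    have h1 : R⁻¹ ≤ (1 - a * y)⁻¹ := inv_anti₀ (by linarith) hR1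
    have h2 : (1 - a * y)⁻¹ = 1 + a * y + (a * y) ^ 2 / (1 - a * y) := by
      have : 1 - a * y ≠ 0 := by linarith
      field_simp
      ring
    linarith
  have hP1 : P < 1 := by nlinarith
  have hmain : 2 * P * (a ^ 2 / (1 - a * y)) ≤ Real.sqrt (P⁻¹ ^ 2 - 1) := by
    have hd : 0 < 1 - a * y := by linarith
    obtain ⟨C, hC, hCa, hCP⟩ : ∃ C, 0 < C ∧ 1 / (1 - a * y) ≤ C ∧ 4 * C ^ 2 * (P ^ 3 * a ^ 3) ≤ 1 := by
      rcases h with h | ⟨-, h⟩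
      · refine ⟨4 / 3, by norm_num, ?_, ?_⟩
        · rw [div_le_iff₀ hd]; nlinarith
        · have : P ^ 3 * a ^ 3 ≤ 1 ^ 3 * (1 / 2) ^ 3 := by gcongr
          linarith
      · refine ⟨2, by norm_num, ?_, ?_⟩
        · rw [div_le_iff₀ hd]; linarith
        · have : P ^ 3 * a ^ 3 ≤ (3 / 8) ^ 3 * 1 ^ 3 := by gcongr
          linarith
    calc 2 * P * (a ^ 2 / (1 - a * y)) = 2 * P * (a ^ 2 * (1 / (1 - a * y))) := by ring
      _ ≤ 2 * P * (a ^ 2 * C) := by gcongr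
      _ ≤ _ := by
        refine Real.le_sqrt_of_sq_le ?_
        have hinv : P⁻¹ ^ 2 - 1 = (1 - P ^ 2) / P ^ 2 := by field_simp
        rw [hinv, le_div_iff₀ (by positivity)]
        have h1 : a * P * (4 * C ^ 2 * (P ^ 3 * a ^ 3)) ≤ a * P * 1 := by gcongr
        nlinarith
  rw [show 2 * (P * R⁻¹ - P) - 2 * P * a * y = 2 * P * (R⁻¹ - 1 - a * y) by ring,
    abs_of_nonneg (mul_nonneg (by positivity) (by linarith))]
  calc 2 * P * (R⁻¹ - 1 - a * y) ≤ 2 * P * ((a * y) ^ 2 / (1 - a * y)) := by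
        gcongr; linarith
    _ = 2 * P * (a ^ 2 / (1 - a * y)) * y ^ 2 := by ring
    _ ≤ _ := by gcongr

/-- For the corank distribution `p_n` of a uniformly random `n×(n+m)` matrix
over a field with `q` elements,
`|Σ_i |p_n(i) − π_m(i)| − (2π_m(0)/((q−1)q^m))·q^{−n}| ≤ (π_m(0)^{−2} − 1)^{1/2}·q^{−2n}`. -/
theorem stmt3 (q : ℕ) (hq : IsPrimePow q) (m n : ℕ) (hn : 1 ≤ n)
    (F : Type) [Field F] [Fintype F] (hF : Fintype.card F = q)
    (pn : ℕ → ℝ)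
    (hpn : ∀ i : ℕ, pn i =
      (Nat.card {M : Matrix (Fin n) (Fin (n + m)) F // n - M.rank = i} : ℝ)
        / (q : ℝ) ^ (n * (n + m))) :
    |(∑' i : ℕ, |pn i - piCL q m i|)
        - (2 * piCL q m 0 / (((q : ℝ) - 1) * (q : ℝ) ^ m)) * (q : ℝ)⁻¹ ^ n|
      ≤ Real.sqrt ((piCL q m 0)⁻¹ ^ 2 - 1) * (q : ℝ)⁻¹ ^ (2 * n) := by
  subst hF
  have hpn' : pn = corankProb F m n := funext hpn
  have hq1 : (1 : ℝ) < Fintype.card F := by exact_mod_cast Fintype.one_lt_card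
  have hq2 : (2 : ℝ) ≤ Fintype.card F := by exact_mod_cast Fintype.one_lt_card
  have hP := piCL_pos (Fintype.one_lt_card (α := F)) m 0
  have hPeq : piCL (Fintype.card F) m 0 = etaInf (Fintype.card F) / etaF (Fintype.card F) m := by
    simp [piCL, etaF_zero]
  have hp0 := corankProb_eq F (m := m) (Nat.zero_le n)
  have hs : ∀ h0, _ := fun h0 => tsum_abs_sub_of_hasSum_one (hasSum_corankProb F m n)
    (hasSum_piCL F m) h0 fun i hi => corankProb_le_piCL F m n hi
  rw [hpn']
  set P := piCL (Fintype.card F) m 0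
  set q : ℝ := (Fintype.card F : ℝ)
  have hI := etaInf_pos hq1
  have hm := etaF_pos hq1 m
  have hn' := etaF_pos hq1 n
  have hnm := etaF_pos hq1 (n + m)
  have hinv : q⁻¹ ≤ 1 / 2 := by rw [inv_eq_one_div]; gcongr
  have hinv0 : 0 < q⁻¹ := by positivity
  set a := q⁻¹ ^ m / (q - 1) with ha
  have hq10 : 0 < q - 1 := by linarith
  have hq1' : 1 ≤ q - 1 := by linarith
  have ha0 : 0 < a := by positivity
  have hay : q⁻¹ ^ (n + m) / (q - 1) = a * q⁻¹ ^ n := by rw [ha, pow_add]; ring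
  have hbm := etaInf_bounds hq1 m
  have hbn := etaInf_bounds hq1 (n + m)
  rw [hay] at hbn
  rw [Nat.sub_zero, show etaF q n * etaF q (n + m) / (etaInf q * etaF q n) =
    (etaInf q / etaF q (n + m))⁻¹ by field_simp] at hp0
  have hle : P ≤ corankProb F m n 0 := by
    rw [hp0]
    refine le_mul_of_one_le_right hP.le ((one_le_inv₀ (by positivity)).mpr ?_)
    exact (div_le_one hnm).mpr (etaInf_le_etaF hq1 _)
  have hy2 : q⁻¹ ^ n ≤ 1 / 2 :=
    (pow_le_of_le_one hinv0.le (by linarith) (by omega)).trans hinv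
  rw [hs hle, hp0, pow_mul', show 2 * P / ((q - 1) * q ^ m) * q⁻¹ ^ n = 2 * P * a * q⁻¹ ^ n by
    rw [ha, inv_pow, inv_pow]; field_simp]
  refine abs_two_mul_inv_sub_le hP ha0 (by positivity) hy2 ?_ ?_ ?_ ?_
  · rw [hPeq, div_mul_eq_mul_div, div_le_one hm]
    exact hbm.2
  · rw [le_div_iff₀ hnm, mul_comm]
    exact hbn.1
  · rw [div_mul_eq_mul_div, div_le_one hnm]
    exact hbn.2
  · have hPle : P ≤ etaF q (m + 2) / etaF q m := by
      rw [hPeq]; gcongr; exact etaInf_le_etaF hq1 _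
    rcases Nat.eq_zero_or_pos m with rfl | hm0
    · rcases (Nat.succ_le_of_lt (Fintype.one_lt_card (α := F))).eq_or_lt with h | h
      · have hq : q = 2 := by simp only [q, ← h]; norm_num
        right
        rw [hq] at hPle
        constructor
        · rw [ha, hq]; norm_num
        · refine hPle.trans ?_
          norm_num [etaF, Finset.prod_range_succ]
      · have hq3 : (3 : ℝ) ≤ Fintype.card F := by exact_mod_cast h
        change 3 ≤ q at hq3
        left
        rw [ha, pow_zero]
        gcongr
        linarith
    · left
      calc a ≤ q⁻¹ ^ m := div_le_self (by positivity) hq1'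
        _ ≤ q⁻¹ := pow_le_of_le_one hinv0.le (by linarith) (by omega)
        _ ≤ _ := hinv
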